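/- Let k ≥ 1 and let A be a k-fair DFA with n states over Σ satisfying the diamond property with respect to I_loc. Then there exists a finite asynchronous automaton B over (Σ, loc) with L_t(B) = L_t(A) such that for every process p ∈ P, the set of local states Q_p of B has cardinality at most 2k · n · (2|Σ| + 1)^{3k}. In particular, the local state bound is linear in n and independent of the number of processes. -/

import Mathlib

variable {α P : Type*}

/-- One swap of two adjacent independent letters. -/
def SwapAdj [DecidableEq P] (loc : α → Finset P) (w w' : List α) : Prop :=
  ∃ (u v : List α) (a b : α), loc a ∩ loc b = ∅ ∧
    w = u ++ a :: b :: v ∧ w' = u ++ b :: a :: v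

/-- Trace equivalence: finitely many swaps of adjacent independent letters. -/
def TraceEquiv [DecidableEq P] (loc : α → Finset P) : List α → List α → Prop :=
  Relation.ReflTransGen (SwapAdj loc)

/-- The set of processes participating in a word. -/
def locWord [DecidableEq P] (loc : α → Finset P) (w : List α) : Finset P :=
  w.foldr (fun a s => loc a ∪ s) ∅

/-- Deterministic finite-state automaton with partial transition function. -/
structure DetAut (α Q : Type*) where
  init : Q
  step : Q → α → Option Q
  final : Set Q

/-- Extended (partial) transition function on words. -/
def DetAut.run {Q : Type*} (A : DetAut α Q) (q : Q) (w : List α) : Option Q :=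
  w.foldlM A.step q

/-- The word language accepted by the DFA. -/
def DetAut.lang {Q : Type*} (A : DetAut α Q) : Set (List α) :=
  {w | ∃ qf ∈ A.final, A.run A.init w = some qf}

/-- The diamond property of a DFA with respect to the independence relation. -/
def DetAut.Diamond {Q : Type*} [DecidableEq P] (loc : α → Finset P)
    (A : DetAut α Q) : Prop :=
  ∀ a b q q' q'', loc a ∩ loc b = ∅ →
    A.step q a = some q' → A.step q' b = some q'' →
    ∃ q''', A.step q b = some q''' ∧ A.step q''' a = some q''

def DetAut.Reachable {Q : Type*} (A : DetAut α Q) (q : Q) : Prop :=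
  ∃ w, A.run A.init w = some q

def DetAut.Coreachable {Q : Type*} (A : DetAut α Q) (q : Q) : Prop :=
  ∃ w qf, A.run q w = some qf ∧ qf ∈ A.final

/-- A DFA is `k`-fair. -/
def DetAut.KFair {Q : Type*} [DecidableEq P] [Fintype P] (loc : α → Finset P)
    (A : DetAut α Q) (k : ℕ) : Prop :=
  ∀ q, A.Reachable q → ∀ u q', k ≤ u.length → A.run q u = some q' →
    A.Coreachable q' → locWord loc u = Finset.univ

/-- Asynchronous automaton over a distributed alphabet `(α, loc)`: the
transition for letter `a` only reads and writes the components of processes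
in `loc a`. -/
structure AsyncAut (α : Type*) {P : Type*} (loc : α → Finset P) (Q : P → Type*) where
  init : ∀ p, Q p
  trans : α → (∀ p, Q p) → (∀ p, Q p)
  final : Set (∀ p, Q p)
  trans_untouched : ∀ a s p, p ∉ loc a → trans a s p = s p
  trans_local : ∀ a s s', (∀ p ∈ loc a, s p = s' p) →
    ∀ p ∈ loc a, trans a s p = trans a s' p

/-- The global state reached from the initial state when reading `w`
in the semantics of the asynchronous automaton. -/
def AsyncAut.run {loc : α → Finset P} {Q : P → Type*}
    (B : AsyncAut α loc Q) (w : List α) : ∀ p, Q p :=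
  w.foldl (fun s a => B.trans a s) B.init

/-- The word language accepted by the asynchronous automaton. -/
def AsyncAut.lang {loc : α → Finset P} {Q : P → Type*}
    (B : AsyncAut α loc Q) : Set (List α) :=
  {w | B.run w ∈ B.final}

/-- The set of traces of words of `L`, represented by all their linearisations;
two languages have the same set of traces iff their `traceClosure`s coincide. -/
def traceClosure [DecidableEq P] (loc : α → Finset P) (L : Set (List α)) :
    Set (List α) :=
  {w' | ∃ w ∈ L, TraceEquiv loc w w'}


set_option linter.unusedSectionVars false

section Abstract

theorem exists_async_of_views {α P σ : Type*} (loc : α → Finset P) (n : ℕ)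
    (c : σ ↪ Fin n)
    (view : List α → P → σ)
    (ha : ∀ w a p, p ∉ loc a → view (w ++ [a]) p = view w p)
    (hb : ∀ w w' a, (∀ p ∈ loc a, view w p = view w' p) →
      ∀ p ∈ loc a, view (w ++ [a]) p = view (w' ++ [a]) p)
    (L : Set (List α))
    (hc : ∀ w w', (∀ p, view w p = view w' p) → w ∈ L → w' ∈ L) :
    ∃ B : AsyncAut α loc (fun _ : P => Fin n), B.lang = L := by
  classical
  let tr : α → (P → Fin n) → (P → Fin n) := fun a s p =>
    if h : p ∈ loc a ∧ ∃ w, ∀ q ∈ loc a, c (view w q) = s q then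
      c (view (h.2.choose ++ [a]) p) else s p
  have key : ∀ w a s, (∀ q ∈ loc a, c (view w q) = s q) → ∀ p ∈ loc a,
      tr a s p = c (view (w ++ [a]) p) := by
    intro w a s h p hp
    have hx : p ∈ loc a ∧ ∃ w, ∀ q ∈ loc a, c (view w q) = s q := ⟨hp, w, h⟩
    simp only [tr, dif_pos hx]
    congr 1
    apply hb _ _ _ _ p hp
    intro q hq
    apply c.injective
    rw [hx.2.choose_spec q hq, h q hq]
  let B : AsyncAut α loc (fun _ : P => Fin n) :=
    { init := fun p => c (view [] p)
      trans := tr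
      final := {s | ∃ w ∈ L, s = fun p => c (view w p)}
      trans_untouched := by
        intro a s p hp
        simp [tr, hp]
      trans_local := by
        intro a s s' h p hp
        by_cases hx : ∃ w, ∀ q ∈ loc a, c (view w q) = s q
        · obtain ⟨w, hw⟩ := hx
          rw [key w a s hw p hp, key w a s' (fun q hq => (hw q hq).trans (h q hq)) p hp]
        · have hx' : ¬ ∃ w, ∀ q ∈ loc a, c (view w q) = s' q := by
            rintro ⟨w, hw⟩
            exact hx ⟨w, fun q hq => (hw q hq).trans (h q hq).symm⟩
          simp only [tr, hx, hx', and_false, dif_neg, not_false_eq_true]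
          exact h p hp }
  have hrun : ∀ w, B.run w = fun p => c (view w p) := by
    intro w
    induction w using List.reverseRecOn with
    | nil => rfl
    | append_singleton w a ih =>
      have h1 : B.run (w ++ [a]) = tr a (B.run w) := by
        simp [AsyncAut.run, B]
      rw [h1, ih]
      funext p
      by_cases hp : p ∈ loc a
      · exact key w a _ (fun _ _ => rfl) p hp
      · rw [ha w a p hp]
        simp [tr, hp]
  refine ⟨B, ?_⟩
  ext w
  constructor
  · rintro ⟨w', hw', h⟩
    rw [hrun] at h
    exact hc w' w (fun p => (c.injective (congrFun h p)).symm) hw'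
  · intro hw
    exact ⟨w, hw, hrun w⟩

end Abstract

section Heap

abbrev Ev (α : Type*) := ℤ ×ₗ α

def Ev.h {α : Type*} (x : Ev α) : ℤ := (ofLex x).1
def Ev.l {α : Type*} (x : Ev α) : α := (ofLex x).2
def Ev.mk {α : Type*} (m : ℤ) (a : α) : Ev α := toLex (m, a)

@[simp] theorem Ev.mk_h {α : Type*} (m : ℤ) (a : α) : (Ev.mk m a).h = m := rfl
@[simp] theorem Ev.mk_l {α : Type*} (m : ℤ) (a : α) : (Ev.mk m a).l = a := rfl

theorem Ev.ext' {α : Type*} {x y : Ev α} (h1 : x.h = y.h) (h2 : x.l = y.l) : x = y :=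
  Prod.ext h1 h2

def Ev.sh {α : Type*} (d : ℤ) (x : Ev α) : Ev α := Ev.mk (x.h + d) x.l

@[simp] theorem Ev.sh_h {α : Type*} (d : ℤ) (x : Ev α) : (x.sh d).h = x.h + d := rfl
@[simp] theorem Ev.sh_l {α : Type*} (d : ℤ) (x : Ev α) : (x.sh d).l = x.l := rfl

theorem Ev.sh_neg {α : Type*} (d : ℤ) (x : Ev α) : (x.sh d).sh (-d) = x :=
  Ev.ext' (by simp) (by simp)

theorem Ev.sh_neg' {α : Type*} (d : ℤ) (x : Ev α) : (x.sh (-d)).sh d = x :=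
  Ev.ext' (by simp) (by simp)

theorem Ev.sh_inj {α : Type*} (d : ℤ) : Function.Injective (Ev.sh (α := α) d) := by
  intro x y h
  rw [← Ev.sh_neg d x, ← Ev.sh_neg d y, h]

theorem Ev.lt_iff {α : Type*} [LinearOrder α] {x y : Ev α} :
    x < y ↔ x.h < y.h ∨ (x.h = y.h ∧ x.l < y.l) := Prod.Lex.lt_iff

theorem Ev.sh_lt {α : Type*} [LinearOrder α] (d : ℤ) {x y : Ev α} :
    x.sh d < y.sh d ↔ x < y := by
  simp [Ev.lt_iff]

theorem Ev.h_le_of_lt {α : Type*} [LinearOrder α] {x y : Ev α} (h : x < y) : x.h ≤ y.h := by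
  rcases Ev.lt_iff.1 h with h | h
  · exact h.le
  · exact h.1.le

theorem Ev.h_le_of_le {α : Type*} [LinearOrder α] {x y : Ev α} (h : x ≤ y) : x.h ≤ y.h := by
  rcases h.eq_or_lt with h | h
  · rw [h]
  · exact Ev.h_le_of_lt h

theorem Ev.lt_of_h {α : Type*} [LinearOrder α] {x y : Ev α} (h : x.h < y.h) : x < y :=
  Ev.lt_iff.2 (Or.inl h)

/-- compatibility relation for linearisations -/
def Cmp {α P : Type*} (loc : α → Finset P) (x y : Ev α) : Prop :=
  ∀ p, p ∈ loc x.l → p ∈ loc y.l → x.h < y.h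

theorem run_append {α Q : Type*} (A : DetAut α Q) (q : Q) (u v : List α) :
    A.run q (u ++ v) = (A.run q u).bind (fun q' => A.run q' v) := by
  simp [DetAut.run, List.foldlM_append]

theorem run_cons {α Q : Type*} (A : DetAut α Q) (q : Q) (a : α) (v : List α) :
    A.run q (a :: v) = (A.step q a).bind (fun q' => A.run q' v) := by
  simp [DetAut.run, List.foldlM_cons]

@[simp] theorem run_nil {α Q : Type*} (A : DetAut α Q) (q : Q) :
    A.run q [] = some q := rfl

theorem run_swap {α P Q : Type*} [DecidableEq P] {loc : α → Finset P} {A : DetAut α Q}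
    (hd : A.Diamond loc) (q : Q) (a b : α) (hab : loc a ∩ loc b = ∅) (v : List α) :
    A.run q (a :: b :: v) = A.run q (b :: a :: v) := by
  have key : ∀ a b : α, loc a ∩ loc b = ∅ → ∀ r, A.run q [a, b] = some r →
      A.run q [b, a] = some r := by
    intro a b hab r h
    simp only [run_cons, run_nil, Option.bind_eq_some_iff] at h ⊢
    obtain ⟨q1, h1, q2, h2, h3⟩ := h
    obtain ⟨q3, h4, h5⟩ := hd a b q q1 q2 hab h1 h2
    exact ⟨q3, h4, q2, h5, h3⟩
  have e : A.run q [a, b] = A.run q [b, a] := by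
    apply Option.ext
    intro r
    exact ⟨key a b hab r, key b a (by rw [Finset.inter_comm]; exact hab) r⟩
  have e1 : A.run q (a :: b :: v) = A.run q ([a, b] ++ v) := rfl
  have e2 : A.run q (b :: a :: v) = A.run q ([b, a] ++ v) := rfl
  rw [e1, e2, run_append, run_append, e]

theorem run_move {α P Q : Type*} [DecidableEq P] {loc : α → Finset P} {A : DetAut α Q}
    (hd : A.Diamond loc) (a : α) (u v : List α) (hu : ∀ b ∈ u, loc a ∩ loc b = ∅) (q : Q) :
    A.run q (u ++ a :: v) = A.run q (a :: (u ++ v)) := by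
  induction u generalizing q with
  | nil => rfl
  | cons b u ih =>
    have h1 : loc a ∩ loc b = ∅ := hu b (by simp)
    have h2 := fun q => ih (fun b hb => hu b (by simp [hb])) q
    rw [List.cons_append, List.cons_append, run_swap hd q a b h1, run_cons, run_cons]
    congr 1
    funext q'
    exact h2 q'

theorem run_perm {α P Q : Type*} [DecidableEq P] {loc : α → Finset P} {A : DetAut α Q}
    (hd : A.Diamond loc) (l l' : List (Ev α)) (hp : l.Perm l')
    (h : l.Pairwise (Cmp loc)) (h' : l'.Pairwise (Cmp loc)) (q : Q) :
    A.run q (l.map Ev.l) = A.run q (l'.map Ev.l) := by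
  induction l generalizing l' q with
  | nil => rw [List.nil_perm.1 hp]
  | cons x l ih =>
    obtain ⟨u, v, rfl⟩ := List.append_of_mem (hp.subset (List.mem_cons_self))
    have hp' : l.Perm (u ++ v) := by
      have := hp.trans List.perm_middle
      exact List.perm_cons x |>.1 this
    have hx := List.pairwise_cons.1 h
    have hsub : (u ++ v).Pairwise (Cmp loc) :=
      h'.sublist (List.Sublist.append_left (List.sublist_cons_self _ _) _)
    have := ih (u ++ v) hp' hx.2 hsub
    rw [List.map_append, List.map_cons, List.map_cons, run_move hd x.l, run_cons, run_cons,
      ← List.map_append]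
    · congr 1
      funext q'
      exact this q'
    · intro b hb
      obtain ⟨y, hy, rfl⟩ := List.mem_map.1 hb
      by_contra hne
      obtain ⟨p, hpp⟩ := Finset.nonempty_iff_ne_empty.2 hne
      rw [Finset.mem_inter] at hpp
      have h1 := hx.1 y (hp'.symm.subset (by simp [hy])) p hpp.1 hpp.2
      have h2 := (List.pairwise_append.1 h').2.2 y hy x (by simp) p hpp.2 hpp.1
      omega

/-- Heap condition -/
def IsHeap {α P : Type*} (loc : α → Finset P) (T : Finset (Ev α)) : Prop :=
  ∀ x ∈ T, ∀ y ∈ T, ∀ p, p ∈ loc x.l → p ∈ loc y.l → x.h = y.h → x = y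

/-- `V` is a down-closed subset of `T`. -/
def Down {α P : Type*} (loc : α → Finset P) (V T : Finset (Ev α)) : Prop :=
  V ⊆ T ∧ ∀ y ∈ V, ∀ x ∈ T, ∀ p, p ∈ loc x.l → p ∈ loc y.l → x.h < y.h → x ∈ V

theorem IsHeap.mono {α P : Type*} {loc : α → Finset P} {T V : Finset (Ev α)}
    (h : IsHeap loc T) (hV : V ⊆ T) : IsHeap loc V :=
  fun x hx y hy => h x (hV hx) y (hV hy)

theorem Down.mono {α P : Type*} {loc : α → Finset P} {T V W : Finset (Ev α)}
    (h : Down loc V T) (hW : W ⊆ T) (hV : V ⊆ W) : Down loc V W :=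
  ⟨hV, fun y hy x hx => h.2 y hy x (hW hx)⟩

variable {α P QA : Type*} [LinearOrder α] [DecidableEq P]

def lin (V : Finset (Ev α)) : List α := V.sort.map Ev.l

theorem pairwise_sort_cmp {loc : α → Finset P} {V : Finset (Ev α)} (h : IsHeap loc V) :
    V.sort.Pairwise (Cmp loc) := by
  have h1 : V.sort.Pairwise (fun x y => x < y) := (V.sortedLT_sort).pairwise
  refine h1.imp_of_mem ?_
  intro x y hx hy hxy p hp hp'
  rw [Finset.mem_sort] at hx hy
  rcases Ev.lt_iff.1 hxy with h2 | h2
  · exact h2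
  · exact absurd (h x hx y hy p hp hp' h2.1) hxy.ne

theorem run_lin_of_perm {loc : α → Finset P} {A : DetAut α QA} (hd : A.Diamond loc)
    {V : Finset (Ev α)} (h : IsHeap loc V) (l : List (Ev α)) (hl : l.Nodup)
    (hmem : ∀ x, x ∈ l ↔ x ∈ V) (hc : l.Pairwise (Cmp loc)) (q : QA) :
    A.run q (lin V) = A.run q (l.map Ev.l) := by
  apply run_perm hd _ _ _ (pairwise_sort_cmp h) hc
  rw [List.perm_ext_iff_of_nodup (Finset.sort_nodup _ _) hl]
  intro x
  rw [Finset.mem_sort, hmem]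

theorem run_split {loc : α → Finset P} {A : DetAut α QA} (hd : A.Diamond loc)
    {V T : Finset (Ev α)} (hT : IsHeap loc T) (hV : Down loc V T) (q : QA) :
    A.run q (lin T) = (A.run q (lin V)).bind (fun q' => A.run q' (lin (T \ V))) := by
  rw [← run_append]
  unfold lin
  rw [← List.map_append]
  apply run_lin_of_perm hd hT
  · rw [List.nodup_append]
    refine ⟨Finset.sort_nodup _ _, Finset.sort_nodup _ _, ?_⟩
    intro a ha b hb
    rw [Finset.mem_sort] at ha hb
    rintro rfl
    exact (Finset.mem_sdiff.1 hb).2 ha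
  · intro x
    simp only [List.mem_append, Finset.mem_sort, Finset.mem_sdiff]
    have := @hV.1 x
    tauto
  · rw [List.pairwise_append]
    refine ⟨pairwise_sort_cmp (hT.mono hV.1), pairwise_sort_cmp (hT.mono Finset.sdiff_subset), ?_⟩
    intro x hx y hy p hp hp'
    rw [Finset.mem_sort] at hx hy
    rw [Finset.mem_sdiff] at hy
    by_contra hlt
    rcases (not_lt.1 hlt).eq_or_lt with h1 | h1
    · exact hy.2 (hT y hy.1 x (hV.1 hx) p hp' hp h1 ▸ hx)
    · exact hy.2 (hV.2 x hx y hy.1 p hp' hp h1)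

def Live (A : DetAut α QA) (V : Finset (Ev α)) : Prop :=
  ∃ q, A.run A.init (lin V) = some q ∧ A.Coreachable q

theorem coreach_of_run {α QA : Type*} {A : DetAut α QA} {q q' : QA} {u : List α}
    (h : A.run q u = some q') (h' : A.Coreachable q') : A.Coreachable q := by
  obtain ⟨w, qf, h1, h2⟩ := h'
  refine ⟨u ++ w, qf, ?_, h2⟩
  rw [run_append, h]
  exact h1

theorem Live.down {loc : α → Finset P} {A : DetAut α QA} (hd : A.Diamond loc)
    {V T : Finset (Ev α)} (hT : IsHeap loc T) (hV : Down loc V T) (h : Live A T) :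
    Live A V := by
  obtain ⟨q, h1, h2⟩ := h
  rw [run_split hd hT hV, Option.bind_eq_some_iff] at h1
  obtain ⟨q', h3, h4⟩ := h1
  exact ⟨q', h3, coreach_of_run h4 h2⟩

theorem mem_locWord {α P : Type*} [DecidableEq P] {loc : α → Finset P} {w : List α} {p : P}
    (h : p ∈ locWord loc w) : ∃ a ∈ w, p ∈ loc a := by
  induction w with
  | nil => simp [locWord] at h
  | cons a w ih =>
    have : p ∈ loc a ∪ locWord loc w := h
    rcases Finset.mem_union.1 this with h | h
    · exact ⟨a, by simp, h⟩
    · obtain ⟨b, hb, h⟩ := ih h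
      exact ⟨b, by simp [hb], h⟩

theorem fair_card [Fintype P] {loc : α → Finset P} {A : DetAut α QA} (hd : A.Diamond loc)
    {k : ℕ} (hf : A.KFair loc k)
    {V T : Finset (Ev α)} (hT : IsHeap loc T) (hV : Down loc V T) (h : Live A T)
    (p : P) (hp : ∀ x ∈ T, p ∈ loc x.l → x ∈ V) : (T \ V).card < k := by
  by_contra hk
  obtain ⟨q, h1, h2⟩ := h
  rw [run_split hd hT hV, Option.bind_eq_some_iff] at h1
  obtain ⟨q', h3, h4⟩ := h1
  have := hf q' ⟨_, h3⟩ (lin (T \ V)) q (by simpa [lin] using hk) h4 h2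
  have hm : p ∈ locWord loc (lin (T \ V)) := by rw [this]; simp
  obtain ⟨a, ha, hpa⟩ := mem_locWord hm
  simp only [lin, List.mem_map, Finset.mem_sort] at ha
  obtain ⟨x, hx, rfl⟩ := ha
  rw [Finset.mem_sdiff] at hx
  exact hx.2 (hp x hx.1 hpa)

def aft (V : Finset (Ev α)) (e : Ev α) : ℕ := (V.filter (fun f => e < f)).card

def len (V : Finset (Ev α)) : ℤ := ((V.sup fun x => (x.h + 1).toNat : ℕ) : ℤ)

def Gap (V : Finset (Ev α)) : Prop :=
  (∀ x ∈ V, 0 ≤ x.h) ∧ ∀ m : ℤ, 0 ≤ m → m < len V → ∃ x ∈ V, x.h = m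

theorem len_nonneg (V : Finset (Ev α)) : 0 ≤ len V := by unfold len; positivity

theorem lt_len {V : Finset (Ev α)} {x : Ev α} (hx : x ∈ V) : x.h < len V := by
  have := Finset.le_sup (f := fun x : Ev α => (x.h + 1).toNat) hx
  unfold len
  omega

theorem len_union (V W : Finset (Ev α)) : len (V ∪ W) = max (len V) (len W) := by
  unfold len
  rw [Finset.sup_union]
  push_cast
  rfl

theorem len_insert (U : Finset (Ev α)) (a : α) : len (insert (Ev.mk (len U) a) U) = len U + 1 := by
  have h := len_nonneg U
  have : len (insert (Ev.mk (len U) a) U) = max (len U + 1) (len U) := by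
    conv_lhs => unfold len
    rw [Finset.sup_insert]
    push_cast
    rw [Ev.mk_h]
    change max (((len U + 1).toNat : ℕ) : ℤ) (len U) = _
    rw [Int.toNat_of_nonneg (by omega)]
  rw [this]
  omega

theorem len_le {V : Finset (Ev α)} {m : ℤ} (h0 : 0 ≤ m) (h : ∀ x ∈ V, x.h < m) : len V ≤ m := by
  have : V.sup (fun x => (x.h + 1).toNat) ≤ m.toNat := by
    apply Finset.sup_le
    intro x hx
    have := h x hx
    omega
  unfold len
  omega

theorem Gap.union {V W : Finset (Ev α)} (hV : Gap V) (hW : Gap W) : Gap (V ∪ W) := by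
  refine ⟨?_, ?_⟩
  · intro x hx
    rcases Finset.mem_union.1 hx with h | h
    · exact hV.1 x h
    · exact hW.1 x h
  · intro m h0 hm
    rw [len_union, lt_max_iff] at hm
    rcases hm with hm | hm
    · obtain ⟨x, hx, h⟩ := hV.2 m h0 hm
      exact ⟨x, Finset.mem_union_left _ hx, h⟩
    · obtain ⟨x, hx, h⟩ := hW.2 m h0 hm
      exact ⟨x, Finset.mem_union_right _ hx, h⟩

theorem Gap.insert {U : Finset (Ev α)} (hU : Gap U) (a : α) :
    Gap (insert (Ev.mk (len U) a) U) := by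
  refine ⟨?_, ?_⟩
  · intro x hx
    rcases Finset.mem_insert.1 hx with rfl | h
    · exact len_nonneg U
    · exact hU.1 x h
  · intro m h0 hm
    rw [len_insert] at hm
    by_cases h : m < len U
    · obtain ⟨x, hx, h⟩ := hU.2 m h0 h
      exact ⟨x, Finset.mem_insert_of_mem hx, h⟩
    · exact ⟨_, Finset.mem_insert_self _ _, by rw [Ev.mk_h]; omega⟩

theorem aft_lt {V : Finset (Ev α)} {e f : Ev α} (hf : f ∈ V) (h : e < f) : aft V f < aft V e := by
  apply Finset.card_lt_card
  refine ⟨?_, ?_⟩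
  · intro x hx
    rw [Finset.mem_filter] at hx ⊢
    exact ⟨hx.1, h.trans hx.2⟩
  · intro hs
    have : f ∈ V.filter (fun x => f < x) := hs (Finset.mem_filter.2 ⟨hf, h⟩)
    exact lt_irrefl _ (Finset.mem_filter.1 this).2

theorem aft_inj {V : Finset (Ev α)} {e f : Ev α} (he : e ∈ V) (hf : f ∈ V)
    (h : aft V e = aft V f) : e = f := by
  rcases lt_trichotomy e f with h1 | h1 | h1
  · have := aft_lt hf h1; omega
  · exact h1
  · have := aft_lt he h1; omega

theorem aft_mono {V W : Finset (Ev α)} (h : V ⊆ W) (e : Ev α) : aft V e ≤ aft W e :=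
  Finset.card_le_card (Finset.filter_subset_filter _ h)

theorem aft_succ {V : Finset (Ev α)} {e : Ev α} {i : ℕ} (h : aft V e = i + 1) :
    ∃ f ∈ V, aft V f = i ∧ e < f ∧ ∀ g ∈ V, e < g → f ≤ g := by
  have hne : (V.filter (fun f => e < f)).Nonempty := by
    rw [← Finset.card_pos]
    unfold aft at h
    omega
  set f := (V.filter (fun f => e < f)).min' hne with hf
  have hm := Finset.min'_mem _ hne
  rw [← hf, Finset.mem_filter] at hm
  have hmin : ∀ g ∈ V, e < g → f ≤ g := fun g hg heg =>
    Finset.min'_le _ _ (Finset.mem_filter.2 ⟨hg, heg⟩)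
  refine ⟨f, hm.1, ?_, hm.2, hmin⟩
  have : V.filter (fun x => f < x) = (V.filter (fun x => e < x)).erase f := by
    ext x
    simp only [Finset.mem_filter, Finset.mem_erase]
    constructor
    · rintro ⟨h1, h2⟩
      exact ⟨h2.ne', h1, hm.2.trans h2⟩
    · rintro ⟨h1, h2, h3⟩
      exact ⟨h2, lt_of_le_of_ne (hmin x h2 h3) (Ne.symm h1)⟩
  unfold aft at h ⊢
  rw [this, Finset.card_erase_of_mem (Finset.mem_filter.2 hm), h]
  rfl

open Classical in
noncomputable def code (L : ℕ) (V : Finset (Ev α)) (i : Fin L) : Option (α × Bool) :=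
  if h : ∃ e ∈ V, aft V e = i then
    some (h.choose.l, decide (Even (len V - h.choose.h))) else none

theorem code_some {L : ℕ} {V : Finset (Ev α)} {e : Ev α} (he : e ∈ V) (i : Fin L)
    (h : aft V e = i) : code L V i = some (e.l, decide (Even (len V - e.h))) := by
  have hx : ∃ e ∈ V, aft V e = i := ⟨e, he, h⟩
  have : hx.choose = e := aft_inj hx.choose_spec.1 he (hx.choose_spec.2.trans h.symm)
  unfold code
  rw [dif_pos hx, this]

theorem code_none {L : ℕ} {V : Finset (Ev α)} (i : Fin L)
    (h : ¬ ∃ e ∈ V, aft V e = i) : code L V i = none := by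
  unfold code
  rw [dif_neg h]

/-- windows agree up to a shift -/
def WinSub (L : ℕ) (d : ℤ) (V V' : Finset (Ev α)) : Prop :=
  ∀ e ∈ V, aft V e < L → e.sh d ∈ V' ∧ aft V' (e.sh d) = aft V e

theorem code_eq_of_win {L : ℕ} {V V' : Finset (Ev α)} {d : ℤ} (hd : len V' = len V + d)
    (h1 : WinSub L d V V') (h2 : WinSub L (-d) V' V) : code L V = code L V' := by
  funext i
  by_cases hx : ∃ e ∈ V, aft V e = i
  · obtain ⟨e, he, hi⟩ := hx
    obtain ⟨h3, h4⟩ := h1 e he (by rw [hi]; exact i.2)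
    rw [code_some he i hi, code_some h3 i (h4.trans hi)]
    simp only [Ev.sh_l, Ev.sh_h, hd]
    have : len V + d - (e.h + d) = len V - e.h := by ring
    rw [this]
  · rw [code_none i hx, code_none i]
    rintro ⟨e, he, hi⟩
    obtain ⟨h3, h4⟩ := h2 e he (by rw [hi]; exact i.2)
    exact hx ⟨_, h3, h4.trans hi⟩

theorem decode_aux {L : ℕ} {V V' : Finset (Ev α)} (hV : Gap V) (hV' : Gap V')
    (hc : code L V = code L V') (i : ℕ) (hi : i < L) : ∀ e ∈ V, aft V e = i →
    ∃ e' ∈ V', aft V' e' = i ∧ e'.l = e.l ∧ len V - e.h = len V' - e'.h := by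
  have step : ∀ e ∈ V, aft V e = i → ∃ e' ∈ V', aft V' e' = i ∧ e'.l = e.l ∧
      (Even (len V - e.h) ↔ Even (len V' - e'.h)) := by
    intro e he h
    have h1 := code_some he ⟨i, hi⟩ h
    rw [hc] at h1
    by_cases hx : ∃ e' ∈ V', aft V' e' = i
    · obtain ⟨e', he', h'⟩ := hx
      rw [code_some he' ⟨i, hi⟩ h'] at h1
      simp only [Option.some.injEq, Prod.mk.injEq, decide_eq_decide] at h1
      exact ⟨e', he', h', h1.1, h1.2.symm⟩
    · rw [code_none ⟨i, hi⟩ hx] at h1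
      cases h1
  have top : ∀ V : Finset (Ev α), Gap V → ∀ e ∈ V, aft V e = 0 → len V - e.h = 1 := by
    intro V hV e he h
    have h1 := lt_len he
    have h2 := hV.1 e he
    obtain ⟨x, hx, hxm⟩ := hV.2 (len V - 1) (by omega) (by omega)
    have : x ≤ e := by
      by_contra hlt
      have := aft_lt hx (not_le.1 hlt)
      omega
    have := Ev.h_le_of_le this
    omega
  have nxt : ∀ V : Finset (Ev α), Gap V → ∀ e ∈ V, ∀ f : Ev α, e < f →
      (∀ g ∈ V, e < g → f ≤ g) → f ∈ V → f.h - 1 ≤ e.h ∧ e.h ≤ f.h := by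
    intro V hV e he f hef hmin hf
    refine ⟨?_, Ev.h_le_of_lt hef⟩
    by_contra hlt
    have h1 := lt_len hf
    have h2 := hV.1 e he
    obtain ⟨x, hx, hxm⟩ := hV.2 (f.h - 1) (by omega) (by omega)
    have := Ev.h_le_of_le (hmin x hx (Ev.lt_of_h (by omega)))
    omega
  induction i with
  | zero =>
    intro e he h
    obtain ⟨e', he', h1, h2, h3⟩ := step e he h
    refine ⟨e', he', h1, h2, ?_⟩
    rw [top V hV e he h, top V' hV' e' he' h1]
  | succ i ih =>
    intro e he h
    obtain ⟨e', he', h1, h2, h3⟩ := step e he h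
    refine ⟨e', he', h1, h2, ?_⟩
    obtain ⟨f, hf, hfi, hef, hmin⟩ := aft_succ h
    obtain ⟨f', hf', hfi', hef', hmin'⟩ := aft_succ h1
    have ih' : ∀ e ∈ V, aft V e = i →
      ∃ e' ∈ V', aft V' e' = i ∧ e'.l = e.l ∧ len V - e.h = len V' - e'.h := by
      apply ih (Nat.lt_of_succ_lt hi)
      intro e he h
      have h1 := code_some he ⟨i, Nat.lt_of_succ_lt hi⟩ h
      rw [hc] at h1
      by_cases hx : ∃ e' ∈ V', aft V' e' = i
      · obtain ⟨e', he', h'⟩ := hx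
        rw [code_some he' ⟨i, Nat.lt_of_succ_lt hi⟩ h'] at h1
        simp only [Option.some.injEq, Prod.mk.injEq, decide_eq_decide] at h1
        exact ⟨e', he', h', h1.1, h1.2.symm⟩
      · rw [code_none ⟨i, Nat.lt_of_succ_lt hi⟩ hx] at h1
        cases h1
    obtain ⟨g, hg, hgi, -, hgh⟩ := ih' f hf hfi
    have : g = f' := aft_inj hg hf' (hgi.trans hfi'.symm)
    subst this
    have b1 := nxt V hV e he f hef hmin hf
    have b2 := nxt V' hV' e' he' g hef' hmin' hf'
    rw [Int.even_iff, Int.even_iff] at h3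
    omega

theorem win_of_code {L : ℕ} {V V' : Finset (Ev α)} (hV : Gap V) (hV' : Gap V')
    (hc : code L V = code L V') {d : ℤ} (hd : len V' = len V + d) : WinSub L d V V' := by
  intro e he h
  obtain ⟨e', he', h1, h2, h3⟩ := decode_aux hV hV' hc _ h e he rfl
  have : e.sh d = e' := Ev.ext' (by rw [Ev.sh_h]; omega) (by rw [Ev.sh_l, h2])
  rw [this]
  exact ⟨he', h1⟩

theorem len_sub_le {V W : Finset (Ev α)} (hV : Gap V) : len V - len W ≤ (V \ W).card := by
  have hW := len_nonneg W
  have : Finset.Ico (len W) (len V) ⊆ (V \ W).image Ev.h := by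
    intro m hm
    rw [Finset.mem_Ico] at hm
    obtain ⟨x, hx, h⟩ := hV.2 m (by omega) hm.2
    refine Finset.mem_image.2 ⟨x, Finset.mem_sdiff.2 ⟨hx, fun hxW => ?_⟩, h⟩
    have := lt_len hxW
    omega
  have h1 := (Finset.card_le_card this).trans Finset.card_image_le
  rw [Int.card_Ico] at h1
  omega

/-- pair context -/
structure Ctx [Fintype P] (loc : α → Finset P) (A : DetAut α QA) (j : ℕ)
    (V W T : Finset (Ev α)) : Prop where
  heap : IsHeap loc T
  dV : Down loc V T
  dW : Down loc W T
  gV : Gap V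
  gW : Gap W
  lV : Live A V
  lW : Live A W
  cVW : (V \ W).card ≤ j
  cWV : (W \ V).card ≤ j

theorem Ctx.symm [Fintype P] {loc : α → Finset P} {A : DetAut α QA} {j : ℕ}
    {V W T : Finset (Ev α)} (h : Ctx loc A j V W T) : Ctx loc A j W V T :=
  ⟨h.heap, h.dW, h.dV, h.gW, h.gV, h.lW, h.lV, h.cWV, h.cVW⟩

theorem Down.inter {loc : α → Finset P} {V W T : Finset (Ev α)}
    (hV : Down loc V T) (hW : Down loc W T) : Down loc (V ∩ W) T := by
  refine ⟨fun x hx => hV.1 (Finset.mem_inter.1 hx).1, ?_⟩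
  intro y hy x hx p hp hp' hlt
  rw [Finset.mem_inter] at hy ⊢
  exact ⟨hV.2 y hy.1 x hx p hp hp' hlt, hW.2 y hy.2 x hx p hp hp' hlt⟩

theorem Down.union {loc : α → Finset P} {V W T : Finset (Ev α)}
    (hV : Down loc V T) (hW : Down loc W T) : Down loc (V ∪ W) T := by
  refine ⟨Finset.union_subset hV.1 hW.1, ?_⟩
  intro y hy x hx p hp hp' hlt
  rw [Finset.mem_union] at hy ⊢
  rcases hy with hy | hy
  · exact Or.inl (hV.2 y hy x hx p hp hp' hlt)
  · exact Or.inr (hW.2 y hy x hx p hp hp' hlt)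

theorem aft_le_of_mem_sdiff [Fintype P] {loc : α → Finset P} (hloc : ∀ a, (loc a).Nonempty)
    {A : DetAut α QA} (hd : A.Diamond loc) {j : ℕ} (hf : A.KFair loc (j + 1))
    {V W T : Finset (Ev α)} (h : Ctx loc A j V W T) {e : Ev α} (he : e ∈ V) (heW : e ∉ W) :
    aft V e < 2 * j := by
  set C := V ∩ W with hC
  set G := C.filter (fun f => e < f) with hG
  have hCT : Down loc C T := h.dV.inter h.dW
  have hCV : Down loc C V := hCT.mono h.dV.1 Finset.inter_subset_left
  have hCh : IsHeap loc C := h.heap.mono hCT.1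
  have hCl : Live A C := h.lV.down hd (h.heap.mono h.dV.1) hCV
  have hD : Down loc (C \ G) C := by
    refine ⟨Finset.sdiff_subset, ?_⟩
    intro y hy x hx p hp hp' hlt
    simp only [hG, Finset.mem_sdiff, Finset.mem_filter, not_and, not_lt] at hy ⊢
    exact ⟨hx, fun _ => (Ev.lt_of_h hlt).le.trans (hy.2 hy.1)⟩
  obtain ⟨p, hp⟩ := hloc e.l
  have h1 := fair_card hd hf hCh hD hCl p (by
    intro x hx hpx
    rw [Finset.mem_sdiff]
    refine ⟨hx, fun hxG => ?_⟩
    have hlt := (Finset.mem_filter.1 hxG).2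
    rw [hC, Finset.mem_inter] at hx
    rcases (Ev.h_le_of_lt hlt).eq_or_lt with h2 | h2
    · exact hlt.ne (h.heap e (h.dV.1 he) x (h.dV.1 hx.1) p hp hpx h2)
    · exact heW (h.dW.2 x hx.2 e (h.dV.1 he) p hp hpx h2))
  rw [Finset.sdiff_sdiff_eq_self (Finset.filter_subset _ _), ← hG] at h1
  have h2 : V.filter (fun f => e < f) ⊆ G ∪ (V \ W).erase e := by
    intro f hf
    simp only [hG, hC, Finset.mem_filter, Finset.mem_union, Finset.mem_erase, Finset.mem_sdiff,
      Finset.mem_inter] at hf ⊢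
    by_cases hfW : f ∈ W
    · exact Or.inl ⟨⟨hf.1, hfW⟩, hf.2⟩
    · exact Or.inr ⟨hf.2.ne', hf.1, hfW⟩
  have h3 := (Finset.card_le_card h2).trans (Finset.card_union_le _ _)
  have he' : e ∈ V \ W := Finset.mem_sdiff.2 ⟨he, heW⟩
  have h5 : 0 < (V \ W).card := Finset.card_pos.2 ⟨e, he'⟩
  rw [Finset.card_erase_of_mem he'] at h3
  have h4 := h.cVW
  unfold aft
  omega

theorem merge_diff [Fintype P] {loc : α → Finset P} (hloc : ∀ a, (loc a).Nonempty)
    {A : DetAut α QA} (hd : A.Diamond loc) {j : ℕ} (hf : A.KFair loc (j + 1))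
    {V W T V' W' T' : Finset (Ev α)} (h : Ctx loc A j V W T) (h' : Ctx loc A j V' W' T')
    {d : ℤ} (hV : WinSub (3 * (j + 1)) d V V') (hW : WinSub (3 * (j + 1)) (-d) W' W)
    {e : Ev α} (he : e ∈ V \ W) : e.sh d ∈ V' \ W' := by
  rw [Finset.mem_sdiff] at he ⊢
  have h1 := aft_le_of_mem_sdiff hloc hd hf h he.1 he.2
  obtain ⟨h2, h3⟩ := hV e he.1 (by omega)
  refine ⟨h2, fun h4 => he.2 ?_⟩
  have h5 : aft W' (e.sh d) ≤ aft V' (e.sh d) + (W' \ V').card := by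
    unfold aft
    refine (Finset.card_le_card ?_).trans (Finset.card_union_le _ _)
    intro f hf
    simp only [Finset.mem_filter, Finset.mem_union, Finset.mem_sdiff] at hf ⊢
    by_cases hfV : f ∈ V'
    · exact Or.inl ⟨hfV, hf.2⟩
    · exact Or.inr ⟨hf.1, hfV⟩
  have h6 := h'.cWV
  have := (hW _ h4 (by omega)).1
  rwa [Ev.sh_neg] at this

theorem merge_win [Fintype P] {loc : α → Finset P} (hloc : ∀ a, (loc a).Nonempty)
    {A : DetAut α QA} (hd : A.Diamond loc) {j : ℕ} (hf : A.KFair loc (j + 1))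
    {V W V' W' T' : Finset (Ev α)} (h' : Ctx loc A j V' W' T')
    {d : ℤ} (hV : WinSub (3 * (j + 1)) d V V') (hV' : WinSub (3 * (j + 1)) (-d) V' V)
    (hW : WinSub (3 * (j + 1)) d W W') (hW' : WinSub (3 * (j + 1)) (-d) W' W) :
    WinSub (3 * (j + 1)) d (V ∪ W) (V' ∪ W') := by
  have fwd : ∀ f ∈ V ∪ W, aft (V ∪ W) f < 3 * (j + 1) → f.sh d ∈ V' ∪ W' := by
    intro f hf hfa
    rcases Finset.mem_union.1 hf with h | h
    · exact Finset.mem_union_left _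
        (hV f h (lt_of_le_of_lt (aft_mono Finset.subset_union_left f) hfa)).1
    · exact Finset.mem_union_right _
        (hW f h (lt_of_le_of_lt (aft_mono Finset.subset_union_right f) hfa)).1
  have bV : ∀ f' ∈ V', aft V' f' < 3 * (j + 1) → f'.sh (-d) ∈ V ∪ W := fun f' h1 h2 =>
    Finset.mem_union_left _ (hV' f' h1 h2).1
  have bW : ∀ f' ∈ W', aft W' f' < 3 * (j + 1) → f'.sh (-d) ∈ V ∪ W := fun f' h1 h2 =>
    Finset.mem_union_right _ (hW' f' h1 h2).1
  have bck : ∀ e ∈ V ∪ W, aft (V ∪ W) e < 3 * (j + 1) → ∀ f' ∈ V' ∪ W', e.sh d < f' →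
      f'.sh (-d) ∈ V ∪ W := by
    intro e he hea f' hf' hlt
    rcases Finset.mem_union.1 he with h | h
    · obtain ⟨h1, h2⟩ := hV e h (lt_of_le_of_lt (aft_mono Finset.subset_union_left e) hea)
      have h3 := aft_mono (V := V) (W := V ∪ W) Finset.subset_union_left e
      by_cases hfV : f' ∈ V'
      · have := aft_lt hfV hlt
        exact bV f' hfV (by omega)
      · have hfW : f' ∈ W' := (Finset.mem_union.1 hf').resolve_left hfV
        have := aft_le_of_mem_sdiff hloc hd hf h'.symm hfW hfV
        exact bW f' hfW (by omega)
    · obtain ⟨h1, h2⟩ := hW e h (lt_of_le_of_lt (aft_mono Finset.subset_union_right e) hea)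
      have h3 := aft_mono (V := W) (W := V ∪ W) Finset.subset_union_right e
      by_cases hfW : f' ∈ W'
      · have := aft_lt hfW hlt
        exact bW f' hfW (by omega)
      · have hfV : f' ∈ V' := (Finset.mem_union.1 hf').resolve_right hfW
        have := aft_le_of_mem_sdiff hloc hd hf h' hfV hfW
        exact bV f' hfV (by omega)
  intro e he hea
  refine ⟨fwd e he hea, ?_⟩
  have : (V' ∪ W').filter (fun f => e.sh d < f) =
      ((V ∪ W).filter (fun f => e < f)).image (Ev.sh d) := by
    ext f'
    simp only [Finset.mem_filter, Finset.mem_image]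
    constructor
    · rintro ⟨h1, h2⟩
      refine ⟨f'.sh (-d), ⟨bck e he hea f' h1 h2, ?_⟩, Ev.sh_neg' d f'⟩
      rw [← Ev.sh_lt d, Ev.sh_neg']
      exact h2
    · rintro ⟨f, ⟨h1, h2⟩, rfl⟩
      have := aft_lt h1 h2
      exact ⟨fwd f h1 (by omega), (Ev.sh_lt d).2 h2⟩
  unfold aft
  rw [this, Finset.card_image_of_injective _ (Ev.sh_inj d)]

open Classical in
noncomputable def enc (A : DetAut α QA) (j : ℕ) (V : Finset (Ev α)) :
    Option (QA × ZMod (2 * j + 1) × (Fin (3 * (j + 1)) → Option (α × Bool))) :=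
  if Live A V then (A.run A.init (lin V)).map
    (fun q => (q, ((len V : ℤ) : ZMod (2 * j + 1)), code (3 * (j + 1)) V)) else none

theorem enc_dead {A : DetAut α QA} {j : ℕ} {V : Finset (Ev α)} :
    enc A j V = none ↔ ¬ Live A V := by
  unfold enc
  split_ifs with h
  · obtain ⟨q, hq, -⟩ := id h
    simp [hq, h]
  · simp [h]

theorem enc_eq_of {A : DetAut α QA} {j : ℕ} {V V' : Finset (Ev α)}
    (h1 : A.run A.init (lin V) = A.run A.init (lin V'))
    (h2 : ((len V : ℤ) : ZMod (2 * j + 1)) = ((len V' : ℤ) : ZMod (2 * j + 1)))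
    (h3 : code (3 * (j + 1)) V = code (3 * (j + 1)) V') : enc A j V = enc A j V' := by
  unfold enc Live
  rw [h1, h2, h3]

theorem of_enc_eq {A : DetAut α QA} {j : ℕ} {V V' : Finset (Ev α)} (h : enc A j V = enc A j V')
    (hl : Live A V) : Live A V' ∧ A.run A.init (lin V) = A.run A.init (lin V') ∧
    ((len V : ℤ) : ZMod (2 * j + 1)) = ((len V' : ℤ) : ZMod (2 * j + 1)) ∧
    code (3 * (j + 1)) V = code (3 * (j + 1)) V' := by
  have hl' : Live A V' := by
    by_contra hn
    rw [enc_dead.2 hn, enc_dead] at h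
    exact h hl
  obtain ⟨q, hq, -⟩ := id hl
  obtain ⟨q', hq', -⟩ := id hl'
  unfold enc at h
  rw [if_pos hl, if_pos hl', hq, hq'] at h
  simp only [Option.map_some, Option.some.injEq, Prod.mk.injEq] at h
  refine ⟨hl', ?_, h.2.1, h.2.2⟩
  rw [hq, hq', h.1]

theorem enc_merge [Fintype P] {loc : α → Finset P} (hloc : ∀ a, (loc a).Nonempty)
    {A : DetAut α QA} (hd : A.Diamond loc) {j : ℕ} (hf : A.KFair loc (j + 1))
    {V W T V' W' T' : Finset (Ev α)} (h : Ctx loc A j V W T) (h' : Ctx loc A j V' W' T')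
    (eV : enc A j V = enc A j V') (eW : enc A j W = enc A j W') :
    enc A j (V ∪ W) = enc A j (V' ∪ W') := by
  obtain ⟨-, v1, v2, v3⟩ := of_enc_eq eV h.lV
  obtain ⟨-, w1, w2, w3⟩ := of_enc_eq eW h.lW
  obtain ⟨d, hdV⟩ : ∃ d, len V' = len V + d := ⟨len V' - len V, by ring⟩
  have hdW : len W' = len W + d := by
    have a1 := len_sub_le (V := V) (W := W) h.gV
    have a2 := len_sub_le (V := W) (W := V) h.gW
    have a3 := len_sub_le (V := V') (W := W') h'.gV
    have a4 := len_sub_le (V := W') (W := V') h'.gW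
    have b1 := h.cVW
    have b2 := h.cWV
    have b3 := h'.cVW
    have b4 := h'.cWV
    rw [ZMod.intCast_eq_intCast_iff_dvd_sub] at v2 w2
    obtain ⟨x, hx⟩ := v2
    obtain ⟨y, hy⟩ := w2
    push_cast at hx hy
    have hxy : x = y := by
      have e1 : (2 * (j : ℤ) + 1) * (x - y) = (len V' - len W') - (len V - len W) := by
        rw [mul_sub, ← hx, ← hy]; ring
      have e2 : (2 * (j : ℤ) + 1) * (x - y) ≤ 2 * j := by omega
      have e3 : -(2 * (j : ℤ)) ≤ (2 * (j : ℤ) + 1) * (x - y) := by omega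
      have e4 : x - y < 1 := by
        by_contra hc
        have : (2 * (j : ℤ) + 1) * 1 ≤ (2 * (j : ℤ) + 1) * (x - y) :=
          mul_le_mul_of_nonneg_left (by omega) (by omega)
        omega
      have e5 : -1 < x - y := by
        by_contra hc
        have : (2 * (j : ℤ) + 1) * (x - y) ≤ (2 * (j : ℤ) + 1) * (-1) :=
          mul_le_mul_of_nonneg_left (by omega) (by omega)
        omega
      omega
    rw [hxy] at hx
    omega
  have hdV' : len V = len V' + -d := by omega
  have hdW' : len W = len W' + -d := by omega
  have V1 := win_of_code h.gV h'.gV v3 hdV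
  have V2 := win_of_code h'.gV h.gV v3.symm hdV'
  have W1 := win_of_code h.gW h'.gW w3 hdW
  have W2 := win_of_code h'.gW h.gW w3.symm hdW'
  have lenU : len (V' ∪ W') = len (V ∪ W) + d := by
    rw [len_union, len_union]; omega
  have M1 := merge_win hloc hd hf h' V1 V2 W1 W2
  have M2 : WinSub (3 * (j + 1)) (-d) (V' ∪ W') (V ∪ W) :=
    merge_win hloc hd hf h V2 (by rwa [neg_neg]) W2 (by rwa [neg_neg])
  apply enc_eq_of
  · have sd : ∀ V W : Finset (Ev α), (V ∪ W) \ V = W \ V := by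
      intro V W
      ext x
      simp only [Finset.mem_sdiff, Finset.mem_union]
      tauto
    have s1 := run_split hd (h.heap.mono (h.dV.union h.dW).1)
      (h.dV.mono (h.dV.union h.dW).1 Finset.subset_union_left) A.init
    have s2 := run_split hd (h'.heap.mono (h'.dV.union h'.dW).1)
      (h'.dV.mono (h'.dV.union h'.dW).1 Finset.subset_union_left) A.init
    rw [s1, s2, v1]
    congr 1
    funext q
    rw [sd, sd]
    have D1 : ∀ e ∈ W \ V, e.sh d ∈ W' \ V' := fun e he =>
      merge_diff hloc hd hf h.symm h'.symm W1 V2 he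
    have D2 : ∀ e ∈ W' \ V', e.sh (-d) ∈ W \ V := fun e he =>
      merge_diff hloc hd hf h'.symm h.symm W2 (by rwa [neg_neg]) he
    have hp := run_lin_of_perm hd (V := W' \ V')
      (h'.heap.mono (Finset.sdiff_subset.trans h'.dW.1))
      ((W \ V).sort.map (Ev.sh d)) ((Finset.sort_nodup _ _).map (Ev.sh_inj d))
      (by
        intro x
        simp only [List.mem_map, Finset.mem_sort]
        constructor
        · rintro ⟨e, he, rfl⟩
          exact D1 e he
        · intro hx
          exact ⟨_, D2 x hx, Ev.sh_neg' d x⟩)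
      (by
        rw [List.pairwise_map]
        refine (pairwise_sort_cmp (h.heap.mono (Finset.sdiff_subset.trans h.dW.1))).imp ?_
        intro x y hxy p hp hp'
        have := hxy p hp hp'
        simpa using this) q
    rw [hp, List.map_map]
    rfl
  · rw [lenU]
    have : ((d : ℤ) : ZMod (2 * j + 1)) = 0 := by
      rw [hdV] at v2
      push_cast at v2
      exact left_eq_add.1 v2
    push_cast
    rw [this, add_zero]
  · exact code_eq_of_win lenU M1 M2

def top (U : Finset (Ev α)) (a : α) : Ev α := Ev.mk (len U) a

theorem top_notMem (U : Finset (Ev α)) (a : α) : top U a ∉ U := fun h => by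
  have := lt_len h
  simp [top] at this

theorem lt_top {U : Finset (Ev α)} {x : Ev α} (a : α) (hx : x ∈ U) : x < top U a :=
  Ev.lt_of_h (lt_len hx)

theorem run_insert {loc : α → Finset P} {A : DetAut α QA} (hd : A.Diamond loc)
    {T : Finset (Ev α)} {e : Ev α} (hT : IsHeap loc (insert e T))
    (hV : Down loc T (insert e T)) (he : e ∉ T) (q : QA) :
    A.run q (lin (insert e T)) = (A.run q (lin T)).bind (fun q' => A.run q' [e.l]) := by
  rw [run_split hd hT hV]
  have : insert e T \ T = {e} := by
    ext x
    simp only [Finset.mem_sdiff, Finset.mem_insert, Finset.mem_singleton]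
    constructor
    · tauto
    · rintro rfl
      exact ⟨Or.inl rfl, he⟩
  rw [this]
  simp [lin]

theorem aft_insert_top (U : Finset (Ev α)) (a : α) :
    aft (insert (top U a) U) (top U a) = 0 := by
  unfold aft
  rw [Finset.card_eq_zero, Finset.filter_eq_empty_iff]
  intro x hx
  rcases Finset.mem_insert.1 hx with rfl | h
  · exact lt_irrefl _
  · exact (lt_top a h).le.not_gt

theorem aft_insert_mem {U : Finset (Ev α)} (a : α) {x : Ev α} (hx : x ∈ U) :
    aft (insert (top U a) U) x = aft U x + 1 := by
  unfold aft
  rw [Finset.filter_insert, if_pos (lt_top a hx), Finset.card_insert_of_notMem]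
  intro h
  exact top_notMem U a (Finset.mem_filter.1 h).1

theorem win_insert {L : ℕ} {d : ℤ} {U U' : Finset (Ev α)} (a : α) (hd : len U' = len U + d)
    (h : WinSub L d U U') : WinSub L d (insert (top U a) U) (insert (top U' a) U') := by
  intro e he hL
  rcases Finset.mem_insert.1 he with rfl | h1
  · have : (top U a).sh d = top U' a := Ev.ext' (by simp [top, hd]) (by simp [top])
    rw [this, aft_insert_top, aft_insert_top]
    exact ⟨Finset.mem_insert_self _ _, rfl⟩
  · rw [aft_insert_mem a h1] at hL ⊢
    obtain ⟨h2, h3⟩ := h e h1 (by omega)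
    refine ⟨Finset.mem_insert_of_mem h2, ?_⟩
    rw [aft_insert_mem a h2, h3]

theorem enc_insert {loc : α → Finset P}
    {A : DetAut α QA} (hd : A.Diamond loc) {j : ℕ} (a : α)
    {U U' : Finset (Ev α)} (hU : IsHeap loc (insert (top U a) U))
    (hU' : IsHeap loc (insert (top U' a) U'))
    (dU : Down loc U (insert (top U a) U)) (dU' : Down loc U' (insert (top U' a) U'))
    (gU : Gap U) (gU' : Gap U')
    (e : enc A j U = enc A j U') :
    enc A j (insert (top U a) U) = enc A j (insert (top U' a) U') := by
  by_cases hl : Live A U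
  · obtain ⟨-, u1, u2, u3⟩ := of_enc_eq e hl
    obtain ⟨d, hdU⟩ : ∃ d, len U' = len U + d := ⟨len U' - len U, by ring⟩
    have hdU' : len U = len U' + -d := by omega
    apply enc_eq_of
    · rw [run_insert hd hU dU (top_notMem U a), run_insert hd hU' dU' (top_notMem U' a), u1]
      rfl
    · unfold top
      rw [len_insert, len_insert]
      push_cast
      rw [u2]
    · apply code_eq_of_win (d := d)
      · unfold top
        rw [len_insert, len_insert]
        omega
      · exact win_insert a hdU (win_of_code gU gU' u3 hdU)
      · exact win_insert a hdU' (win_of_code gU' gU u3.symm hdU')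
  · have hl' : ¬ Live A U' := by
      rw [← enc_dead (j := j), ← e, enc_dead]
      exact hl
    rw [enc_dead.2 (fun h => hl (h.down hd hU dU)), enc_dead.2 (fun h => hl' (h.down hd hU' dU'))]

def upd (loc : α → Finset P) (V : P → Finset (Ev α)) (a : α) : P → Finset (Ev α) := fun p =>
  if p ∈ loc a then insert (top ((loc a).biUnion V) a) ((loc a).biUnion V) else V p

def views (loc : α → Finset P) (w : List α) : P → Finset (Ev α) :=
  w.foldl (upd loc) (fun _ => ∅)

theorem views_append (loc : α → Finset P) (w : List α) (a : α) :
    views loc (w ++ [a]) = upd loc (views loc w) a := by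
  simp [views]

def tot [Fintype P] (V : P → Finset (Ev α)) : Finset (Ev α) := Finset.univ.biUnion V

structure HInv [Fintype P] (loc : α → Finset P) (V : P → Finset (Ev α)) : Prop where
  heap : IsHeap loc (tot V)
  down : ∀ p, Down loc (V p) (tot V)
  own : ∀ x ∈ tot V, ∀ p ∈ loc x.l, x ∈ V p
  gap : ∀ p, Gap (V p)

theorem gap_empty : Gap (∅ : Finset (Ev α)) :=
  ⟨by simp, by intro m h0 h; simp [len] at h; omega⟩

theorem HInv.gapU [Fintype P] {loc : α → Finset P} {V : P → Finset (Ev α)} (h : HInv loc V)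
    (S : Finset P) : Gap (S.biUnion V) := by
  induction S using Finset.induction_on with
  | empty => simpa using gap_empty
  | insert p S _ ih => rw [Finset.biUnion_insert]; exact (h.gap p).union ih

theorem HInv.downU [Fintype P] {loc : α → Finset P} {V : P → Finset (Ev α)} (h : HInv loc V)
    (S : Finset P) : Down loc (S.biUnion V) (tot V) := by
  induction S using Finset.induction_on with
  | empty => simp [Down]
  | insert p S _ ih => rw [Finset.biUnion_insert]; exact (h.down p).union ih

theorem tot_upd [Fintype P] {loc : α → Finset P} (hloc : ∀ a, (loc a).Nonempty)
    (V : P → Finset (Ev α)) (a : α) :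
    tot (upd loc V a) = insert (top ((loc a).biUnion V) a) (tot V) := by
  ext x
  simp only [tot, Finset.mem_biUnion, Finset.mem_univ, true_and, Finset.mem_insert]
  constructor
  · rintro ⟨p, hp⟩
    unfold upd at hp
    split_ifs at hp with h
    · rcases Finset.mem_insert.1 hp with h1 | h1
      · exact Or.inl h1
      · obtain ⟨q, -, hq⟩ := Finset.mem_biUnion.1 h1
        exact Or.inr ⟨q, hq⟩
    · exact Or.inr ⟨p, hp⟩
  · rintro (rfl | ⟨p, hp⟩)
    · obtain ⟨p, hp⟩ := hloc a
      exact ⟨p, by simp [upd, hp]⟩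
    · refine ⟨p, ?_⟩
      unfold upd
      split_ifs with h
      · exact Finset.mem_insert_of_mem (Finset.mem_biUnion.2 ⟨p, h, hp⟩)
      · exact hp

theorem HInv.dep [Fintype P] {loc : α → Finset P} {V : P → Finset (Ev α)} (h : HInv loc V)
    {a : α} {x : Ev α} (hx : x ∈ tot V) {p : P} (hp : p ∈ loc x.l) (hp' : p ∈ loc a) :
    x ∈ (loc a).biUnion V :=
  Finset.mem_biUnion.2 ⟨p, hp', h.own x hx p hp⟩

theorem HInv.top_notMem [Fintype P] {loc : α → Finset P} (hloc : ∀ a, (loc a).Nonempty)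
    {V : P → Finset (Ev α)} (h : HInv loc V) (a : α) : top ((loc a).biUnion V) a ∉ tot V := by
  intro hx
  obtain ⟨p, hp⟩ := hloc a
  exact _root_.top_notMem _ _ (h.dep hx (p := p) hp hp)

theorem HInv.heap' [Fintype P] {loc : α → Finset P}
    {V : P → Finset (Ev α)} (h : HInv loc V) (a : α) :
    IsHeap loc (insert (top ((loc a).biUnion V) a) (tot V)) := by
  intro x hx y hy p hp hp' hh
  rcases Finset.mem_insert.1 hx with rfl | hx <;> rcases Finset.mem_insert.1 hy with rfl | hy
  · rfl
  · have := lt_len (h.dep (a := a) hy hp' hp)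
    simp [top] at hh
    omega
  · have := lt_len (h.dep (a := a) hx hp hp')
    simp [top] at hh
    omega
  · exact h.heap x hx y hy p hp hp' hh

theorem HInv.down' [Fintype P] {loc : α → Finset P}
    {V : P → Finset (Ev α)} (h : HInv loc V) (a : α) {Z : Finset (Ev α)} (hZ : Down loc Z (tot V)) :
    Down loc Z (insert (top ((loc a).biUnion V) a) (tot V)) := by
  refine ⟨hZ.1.trans (Finset.subset_insert _ _), ?_⟩
  intro y hy x hx p hp hp' hlt
  rcases Finset.mem_insert.1 hx with rfl | hx
  · have := lt_len (h.dep (a := a) (hZ.1 hy) hp' hp)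
    simp [top] at hlt
    omega
  · exact hZ.2 y hy x hx p hp hp' hlt

theorem HInv.upd [Fintype P] {loc : α → Finset P} (hloc : ∀ a, (loc a).Nonempty)
    {V : P → Finset (Ev α)} (h : HInv loc V) (a : α) : HInv loc (upd loc V a) := by
  have hU := h.downU (loc a)
  refine ⟨?_, ?_, ?_, ?_⟩
  · rw [tot_upd hloc]
    exact h.heap' a
  · intro p
    rw [tot_upd hloc]
    unfold _root_.upd
    split_ifs with hpa
    · refine ⟨Finset.insert_subset_insert _ hU.1, ?_⟩
      intro y hy x hx q hq hq' hlt
      rcases Finset.mem_insert.1 hy with rfl | hy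
      · rcases Finset.mem_insert.1 hx with rfl | hx
        · exact Finset.mem_insert_self _ _
        · exact Finset.mem_insert_of_mem (h.dep hx hq hq')
      · exact Finset.mem_insert_of_mem ((h.down' a hU).2 y hy x hx q hq hq' hlt)
    · exact h.down' a (h.down p)
  · intro x hx p hp
    rw [tot_upd hloc] at hx
    unfold _root_.upd
    split_ifs with hpa
    · rcases Finset.mem_insert.1 hx with rfl | hx
      · exact Finset.mem_insert_self _ _
      · exact Finset.mem_insert_of_mem (h.dep hx hp hpa)
    · rcases Finset.mem_insert.1 hx with rfl | hx
      · exact absurd hp hpa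
      · exact h.own x hx p hp
  · intro p
    unfold _root_.upd
    split_ifs with hpa
    · exact (h.gapU (loc a)).insert a
    · exact h.gap p

theorem inv_views [Fintype P] {loc : α → Finset P} (hloc : ∀ a, (loc a).Nonempty)
    (w : List α) : HInv loc (views loc w) := by
  induction w using List.reverseRecOn with
  | nil =>
    have : tot (views loc []) = ∅ := by
      ext x; simp [tot, views]
    refine ⟨?_, ?_, ?_, ?_⟩
    · rw [this]; simp [IsHeap]
    · intro p; simp [views, Down]
    · rw [this]; simp
    · intro p; exact gap_empty
  | append_singleton w a ih =>
    rw [views_append]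
    exact ih.upd hloc a

theorem run_views [Fintype P] {loc : α → Finset P} (hloc : ∀ a, (loc a).Nonempty)
    {A : DetAut α QA} (hd : A.Diamond loc)
    (w : List α) : A.run A.init (lin (tot (views loc w))) = A.run A.init w := by
  induction w using List.reverseRecOn with
  | nil =>
    have : tot (views loc []) = ∅ := by
      ext x; simp [tot, views]
    rw [this]
    simp [lin]
  | append_singleton w a ih =>
    have hI := inv_views hloc w
    rw [views_append, tot_upd hloc, run_insert hd (hI.heap' a)
      (hI.down' a ⟨subset_rfl, fun _ _ x hx _ _ _ _ => hx⟩) (hI.top_notMem hloc a), ih,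
      run_append]
    rfl

theorem HInv.card_le [Fintype P] {loc : α → Finset P}
    {A : DetAut α QA} (hd : A.Diamond loc) {j : ℕ} (hf : A.KFair loc (j + 1))
    {V : P → Finset (Ev α)} (h : HInv loc V) {X Y : Finset (Ev α)}
    (hX : Down loc X (tot V)) (hY : Down loc Y (tot V)) (hl : Live A X) (q : P)
    (hq : V q ⊆ Y) : (X \ Y).card ≤ j := by
  have := fair_card hd hf (h.heap.mono hX.1)
    ((hX.inter hY).mono hX.1 Finset.inter_subset_left) hl q (by
      intro x hx hxq
      exact Finset.mem_inter.2 ⟨hx, hq (h.own x (hX.1 hx) q hxq)⟩)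
  rw [Finset.sdiff_inter_self_left] at this
  omega

theorem enc_biUnion [Fintype P] {loc : α → Finset P} (hloc : ∀ a, (loc a).Nonempty)
    {A : DetAut α QA} (hd : A.Diamond loc) {j : ℕ} (hf : A.KFair loc (j + 1))
    {V V' : P → Finset (Ev α)} (h : HInv loc V) (h' : HInv loc V') (S : Finset P)
    (hS : S.Nonempty) (e : ∀ p ∈ S, enc A j (V p) = enc A j (V' p)) :
    enc A j (S.biUnion V) = enc A j (S.biUnion V') := by
  induction hS using Finset.Nonempty.cons_induction with
  | singleton p => simpa using e p (by simp)
  | cons p S hp hS ih =>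
    have ih' := ih (fun q hq => e q (by simp [hq]))
    have ep := e p (by simp)
    rw [Finset.cons_eq_insert, Finset.biUnion_insert, Finset.biUnion_insert]
    have dead : ∀ V : P → Finset (Ev α), HInv loc V → ∀ Z : Finset (Ev α), Down loc Z (tot V) →
        Z ⊆ V p ∪ S.biUnion V → ¬ Live A Z → enc A j (V p ∪ S.biUnion V) = none := by
      intro V h Z hZ hs hl
      have hu := (h.down p).union (h.downU S)
      exact enc_dead.2 (fun hh => hl (hh.down hd (h.heap.mono hu.1) (hZ.mono hu.1 hs)))
    by_cases l1 : Live A (V p)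
    · by_cases l2 : Live A (S.biUnion V)
      · obtain ⟨q, hq⟩ := hS
        have l1' := (of_enc_eq ep l1).1
        have l2' := (of_enc_eq ih' l2).1
        refine enc_merge (T := tot V) (T' := tot V') hloc hd hf
          ⟨h.heap, h.down p, h.downU S, h.gap p, h.gapU S, l1, l2, ?_, ?_⟩
          ⟨h'.heap, h'.down p, h'.downU S, h'.gap p, h'.gapU S, l1', l2', ?_, ?_⟩ ep ih'
        · exact h.card_le hd hf (h.down p) (h.downU S) l1 q (Finset.subset_biUnion_of_mem V hq)
        · exact h.card_le hd hf (h.downU S) (h.down p) l2 p subset_rfl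
        · exact h'.card_le hd hf (h'.down p) (h'.downU S) l1' q
            (Finset.subset_biUnion_of_mem V' hq)
        · exact h'.card_le hd hf (h'.downU S) (h'.down p) l2' p subset_rfl
      · have l2' : ¬ Live A (S.biUnion V') := by
          rw [← enc_dead (j := j), ← ih', enc_dead]
          exact l2
        rw [dead V h _ (h.downU S) Finset.subset_union_right l2,
          dead V' h' _ (h'.downU S) Finset.subset_union_right l2']
    · have l1' : ¬ Live A (V' p) := by
        rw [← enc_dead (j := j), ← ep, enc_dead]
        exact l1
      rw [dead V h _ (h.down p) Finset.subset_union_left l1,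
        dead V' h' _ (h'.down p) Finset.subset_union_left l1']

theorem enc_upd [Fintype P] {loc : α → Finset P} (hloc : ∀ a, (loc a).Nonempty)
    {A : DetAut α QA} (hd : A.Diamond loc) {j : ℕ} (hf : A.KFair loc (j + 1))
    {V V' : P → Finset (Ev α)} (h : HInv loc V) (h' : HInv loc V') (a : α)
    (e : ∀ p ∈ loc a, enc A j (V p) = enc A j (V' p)) (p : P) (hp : p ∈ loc a) :
    enc A j (upd loc V a p) = enc A j (upd loc V' a p) := by
  have hU := enc_biUnion hloc hd hf h h' (loc a) (hloc a) e
  unfold upd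
  rw [if_pos hp, if_pos hp]
  have sub : ∀ V : P → Finset (Ev α), HInv loc V →
      insert (top ((loc a).biUnion V) a) ((loc a).biUnion V) ⊆
      insert (top ((loc a).biUnion V) a) (tot V) := fun V h =>
    Finset.insert_subset_insert _ (h.downU _).1
  exact enc_insert hd a ((h.heap' a).mono (sub V h)) ((h'.heap' a).mono (sub V' h'))
    ((h.down' a (h.downU _)).mono (sub V h) (Finset.subset_insert _ _))
    ((h'.down' a (h'.downU _)).mono (sub V' h') (Finset.subset_insert _ _))
    (h.gapU _) (h'.gapU _) hU

theorem lang_of_enc [Fintype P] {loc : α → Finset P} (hloc : ∀ a, (loc a).Nonempty)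
    {A : DetAut α QA} (hd : A.Diamond loc) {j : ℕ} (hf : A.KFair loc (j + 1))
    (w w' : List α) (e : ∀ p, enc A j (views loc w p) = enc A j (views loc w' p))
    (hw : w ∈ A.lang) : w' ∈ A.lang := by
  rcases isEmpty_or_nonempty P with hP | hP
  · have hα : ∀ a : α, False := fun a => by
      obtain ⟨p, -⟩ := hloc a
      exact hP.elim p
    have : ∀ w : List α, w = [] := fun w => by
      cases w with
      | nil => rfl
      | cons a _ => exact (hα a).elim
    rw [this w', ← this w]
    exact hw
  · have hU : enc A j (tot (views loc w)) = enc A j (tot (views loc w')) :=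
      enc_biUnion hloc hd hf (inv_views hloc w) (inv_views hloc w') Finset.univ
        Finset.univ_nonempty (fun p _ => e p)
    obtain ⟨qf, h1, h2⟩ := hw
    have hl : Live A (tot (views loc w)) :=
      ⟨qf, by rw [run_views hloc hd, h2], [], qf, rfl, h1⟩
    have := (of_enc_eq hU hl).2.1
    rw [run_views hloc hd, run_views hloc hd, h2] at this
    exact ⟨qf, h1, this.symm⟩

end Heap

/-- (Zielonka's theorem for fair specifications.)
For a `k`-fair DFA with `n` states satisfying the diamond property, there is a
trace-equivalent finite asynchronous automaton whose local state sets have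
cardinality at most `2k · n · (2|Σ| + 1)^(3k)`, a bound linear in `n` and
independent of the number of processes. -/
theorem exists_finite_asyncAut_of_fair {QA : Type*} [DecidableEq P]
    [Fintype α] [Fintype P] [Fintype QA]
    (loc : α → Finset P) (hloc : ∀ a, (loc a).Nonempty)
    (k : ℕ) (hk : 1 ≤ k)
    (A : DetAut α QA) (hdiam : A.Diamond loc) (hfair : A.KFair loc k) :
    ∃ (Q : P → Type) (inst : ∀ p, Fintype (Q p)) (B : AsyncAut α loc Q),
      traceClosure loc B.lang = traceClosure loc A.lang ∧
      ∀ p : P, @Fintype.card (Q p) (inst p) ≤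
        2 * k * Fintype.card QA * (2 * Fintype.card α + 1) ^ (3 * k) := by
  classical
  let : LinearOrder α := LinearOrder.lift' (Fintype.equivFin α) (Fintype.equivFin α).injective
  obtain ⟨j, rfl⟩ : ∃ j, k = j + 1 := ⟨k - 1, by omega⟩
  let σ := Option (QA × ZMod (2 * j + 1) × (Fin (3 * (j + 1)) → Option (α × Bool)))
  obtain ⟨B, hB⟩ := exists_async_of_views (σ := σ) loc (Fintype.card σ)
    (Fintype.equivFin σ).toEmbedding (fun w p => enc A j (views loc w p))
    (by
      intro w a p hp
      rw [views_append]
      simp [upd, hp])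
    (by
      intro w w' a h p hp
      rw [views_append, views_append]
      exact enc_upd hloc hdiam hfair (inv_views hloc w) (inv_views hloc w') a h p hp)
    A.lang (fun w w' h hw => lang_of_enc hloc hdiam hfair w w' h hw)
  refine ⟨fun _ => Fin (Fintype.card σ), fun _ => inferInstance, B, by rw [hB], ?_⟩
  intro p
  rw [Fintype.card_fin]
  have hσ : Fintype.card σ = Fintype.card QA * ((2 * j + 1) *
      (2 * Fintype.card α + 1) ^ (3 * (j + 1))) + 1 := by
    simp only [σ, Fintype.card_option, Fintype.card_prod, ZMod.card, Fintype.card_fun,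
      Fintype.card_fin, Fintype.card_bool]
    rw [mul_comm (Fintype.card α) 2]
  rw [hσ]
  have h1 : 0 < Fintype.card QA := Fintype.card_pos_iff.2 ⟨A.init⟩
  have h2 : 0 < (2 * Fintype.card α + 1) ^ (3 * (j + 1)) := by positivity
  have h3 := Nat.mul_pos h1 h2
  nlinarith
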